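/- arXiv:1401.5927 — 2 statements merged into one kernel-verified Lean document; each statement's English description precedes it below -/
import Mathlib

section
/- Let S_λ be a contractive weighted shift with strictly positive weights on a directed tree 𝒯 = (V, E), and let H₀ = H₀(S_λ) = {h : ‖S_λⁿ h‖ → 0} be its stable subspace. Then for every vertex u ∈ V: (i) if e_u ∈ H₀, then e_v ∈ H₀ for every descendant v ∈ Des(u); (ii) e_u ∈ H₀ if and only if e_v ∈ H₀ for every child v ∈ Chi(u) (in particular e_u ∈ H₀ whenever u is a leaf); (iii) if e_u ∉ H₀, then e_{Par^k(u)} ∉ H₀ for every k ∈ ℤ₊ for which Par^k(u) exists. -/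
open Filter Topology

/-- `E` is the edge relation of a directed tree on the vertex set `V`:
no loops, every vertex has at most one parent, the underlying undirected graph is
connected (any two distinct vertices are joined by a finite undirected path), and
there is no directed circuit. -/
def IsDirectedTree {V : Type*} (E : V → V → Prop) : Prop :=
  (∀ v, ¬ E v v) ∧
  (∀ u u' v, E u v → E u' v → u = u') ∧
  (∀ u v : V, Relation.ReflTransGen (fun a b => E a b ∨ E b a) u v) ∧
  (∀ (n : ℕ) (f : Fin (n + 2) → V), Function.Injective f →
    ¬ ((∀ i : Fin (n + 1), E (f i.castSucc) (f i.succ)) ∧ E (f (Fin.last (n + 1))) (f 0)))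

/-- The set `Chi(W)` of children of the vertices in `W`; its `n`-th iterate applied to `{u}`
is `Chiⁿ(u)`. -/
def chi {V : Type*} (E : V → V → Prop) (W : Set V) : Set V :=
  {v | ∃ u ∈ W, E u v}

/-- The parent `Par(v)` of a vertex `v` (by convention `v` itself if `v` has no parent). -/
noncomputable def par {V : Type*} (E : V → V → Prop) (v : V) : V :=
  haveI := Classical.propDecidable (∃ u, E u v)
  if h : ∃ u, E u v then h.choose else v

/-- `Parⁿ(u)` exists, i.e. the whole ancestor chain of length `n` above `u` exists. -/
def parIterExists {V : Type*} (E : V → V → Prop) (n : ℕ) (u : V) : Prop :=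
  ∀ j < n, ∃ w, E w ((par E)^[j] u)

/-- The level (whole generation) `Gen(u) = ⋃_j Chi^j(Par^j(u))` of a vertex `u`. -/
def gen {V : Type*} (E : V → V → Prop) (u : V) : Set V :=
  ⋃ j : ℕ, (chi E)^[j] {(par E)^[j] u}

/-- The standard orthonormal basis vector `e_u` of `ℓ²(V)`. -/
noncomputable def evec {V : Type*} (u : V) : lp (fun _ : V => ℂ) 2 :=
  haveI := Classical.decEq V
  lp.single 2 u 1

open scoped ComplexOrder

/-- The stable subspace of a continuous linear operator is a linear subspace. -/
def stableSubspace {F : Type*} [NormedAddCommGroup F] [NormedSpace ℂ F] (S : F →L[ℂ] F) :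
    Submodule ℂ F where
  carrier := {x | Tendsto (fun n : ℕ => (S ^ n) x) atTop (𝓝 0)}
  zero_mem' := by simp
  add_mem' := by
    intro x y hx hy
    simpa using Tendsto.add (Set.mem_ofPred.1 hx) (Set.mem_ofPred.1 hy)
  smul_mem' := by
    intro c x hx
    simpa only [Set.mem_ofPred, map_smul, smul_zero] using
      Tendsto.const_smul (Set.mem_ofPred.1 hx) c

section Stable

variable {F : Type*} [NormedAddCommGroup F] [NormedSpace ℂ F] {S : F →L[ℂ] F}

theorem mem_stableSubspace {x : F} :
    x ∈ stableSubspace S ↔ Tendsto (fun n : ℕ => ‖(S ^ n) x‖) atTop (𝓝 0) :=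
  tendsto_zero_iff_norm_tendsto_zero

theorem apply_mem_stableSubspace_iff {x : F} : S x ∈ stableSubspace S ↔ x ∈ stableSubspace S := by
  rw [mem_stableSubspace, mem_stableSubspace,
    ← tendsto_add_atTop_iff_nat (f := fun n : ℕ => ‖(S ^ n) x‖) 1]
  simp only [pow_succ, mul_apply_eq_comp]

theorem norm_pow_apply_le_of_norm_le_one (hS : ‖S‖ ≤ 1) (n : ℕ) (x : F) : ‖(S ^ n) x‖ ≤ ‖x‖ := by
  induction n with
  | zero => simp
  | succ n ih =>
    rw [pow_succ', mul_apply_eq_comp]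
    exact (S.le_of_opNorm_le hS _).trans (by simpa using ih)

theorem isClosed_stableSubspace (hS : ‖S‖ ≤ 1) : IsClosed (stableSubspace S : Set F) := by
  refine isClosed_of_closure_subset fun x hx => ?_
  rw [SetLike.mem_coe, mem_stableSubspace, Metric.tendsto_atTop]
  intro ε hε
  obtain ⟨y, hy, hxy⟩ := Metric.mem_closure_iff.1 hx (ε / 2) (half_pos hε)
  obtain ⟨N, hN⟩ := Metric.tendsto_atTop.1 (mem_stableSubspace.1 hy) (ε / 2) (half_pos hε)
  refine ⟨N, fun n hn => ?_⟩
  have h₁ := hN n hn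
  rw [dist_zero_right, norm_norm] at h₁ ⊢
  have h₂ := norm_pow_apply_le_of_norm_le_one hS n (x - y)
  rw [map_sub, ← dist_eq_norm x y] at h₂
  have h₃ := norm_sub_norm_le ((S ^ n) x) ((S ^ n) y)
  linarith

end Stable

section Lp

variable {V : Type*}

theorem hasSum_smul_evec (f : lp (fun _ : V => ℂ) 2) : HasSum (fun v => f v • evec v) f := by
  classical
  convert lp.hasSum_single (p := 2) (by simp) f using 2 with v
  rw [evec, ← lp.single_smul]
  congr! 2
  simp

theorem hasSum_apply_of_hasSum {ι : Type*} {g : ι → lp (fun _ : V => ℂ) 2}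
    {f : lp (fun _ : V => ℂ) 2} (h : HasSum g f) (v : V) : HasSum (fun i => g i v) (f v) :=
  h.mapL (lp.evalCLM ℂ (fun _ : V => ℂ) 2 v)

theorem lp_norm_le_of_forall_norm_le {f g : lp (fun _ : V => ℂ) 2} (h : ∀ v, ‖f v‖ ≤ ‖g v‖) :
    ‖f‖ ≤ ‖g‖ := by
  have h2 : 0 < (2 : ENNReal).toReal := by norm_num
  refine lp.norm_le_of_tsum_le h2 (norm_nonneg _) ?_
  rw [lp.norm_rpow_eq_tsum h2]
  exact ((lp.memℓp f).summable h2).tsum_le_tsum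
    (fun v => Real.rpow_le_rpow (norm_nonneg _) (h v) h2.le) ((lp.memℓp g).summable h2)

theorem apply_nonneg_of_apply_evec_nonneg {S : lp (fun _ : V => ℂ) 2 →L[ℂ] lp (fun _ : V => ℂ) 2}
    (hS : ∀ u v, 0 ≤ S (evec u) v) {f : lp (fun _ : V => ℂ) 2} (hf : ∀ v, 0 ≤ f v) (v : V) :
    0 ≤ S f v := by
  have h := hasSum_apply_of_hasSum ((hasSum_smul_evec f).mapL S) v
  refine h.nonneg fun w => ?_
  simpa using mul_nonneg (hf w) (hS w v)

theorem pow_apply_nonneg_of_apply_evec_nonneg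
    {S : lp (fun _ : V => ℂ) 2 →L[ℂ] lp (fun _ : V => ℂ) 2}
    (hS : ∀ u v, 0 ≤ S (evec u) v) {f : lp (fun _ : V => ℂ) 2} (hf : ∀ v, 0 ≤ f v)
    (n : ℕ) (v : V) : 0 ≤ (S ^ n) f v := by
  induction n generalizing v with
  | zero => simpa using hf v
  | succ n ih =>
    rw [pow_succ', mul_apply_eq_comp]
    exact apply_nonneg_of_apply_evec_nonneg hS ih v

theorem mem_stableSubspace_of_le {S : lp (fun _ : V => ℂ) 2 →L[ℂ] lp (fun _ : V => ℂ) 2}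
    (hS : ∀ u v, 0 ≤ S (evec u) v) {f g : lp (fun _ : V => ℂ) 2} (hf : ∀ v, 0 ≤ f v)
    (hfg : ∀ v, f v ≤ g v) (hg : g ∈ stableSubspace S) : f ∈ stableSubspace S := by
  rw [mem_stableSubspace] at hg ⊢
  refine squeeze_zero (fun n => norm_nonneg _) (fun n => ?_) hg
  refine lp_norm_le_of_forall_norm_le fun v => ?_
  have h₁ := pow_apply_nonneg_of_apply_evec_nonneg hS hf n v
  have h₂ := pow_apply_nonneg_of_apply_evec_nonneg hS (f := g - f)
    (fun w => by simpa using hfg w) n v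
  refine CStarAlgebra.norm_le_norm_of_nonneg_of_le h₁ ?_
  simpa using h₂

theorem evec_apply_self (u : V) : evec u u = 1 := by
  simp [evec]

theorem evec_apply_of_ne {u v : V} (h : v ≠ u) : evec u v = 0 := by
  simp [evec, h]

theorem evec_nonneg (u v : V) : 0 ≤ evec u v := by
  by_cases h : v = u
  · simp [h, evec_apply_self]
  · simp [evec_apply_of_ne h]

end Lp

theorem evec_mem_stableSubspace_iff {V : Type*} {E : V → V → Prop} {lam : V → ℝ}
    (hlam : ∀ v, (∃ u, E u v) → 0 < lam v)
    {S : lp (fun _ : V => ℂ) 2 →L[ℂ] lp (fun _ : V => ℂ) 2}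
    (hS : ∀ u v : V, (S (evec u)) v = Set.indicator {w | E u w} (fun w => (lam w : ℂ)) v)
    (hcon : ‖S‖ ≤ 1) (u : V) :
    evec u ∈ stableSubspace S ↔ ∀ v, E u v → evec v ∈ stableSubspace S := by
  have hpos : ∀ u v, 0 ≤ S (evec u) v := fun u v => by
    rw [hS]
    exact Set.indicator_nonneg (fun w hw => Complex.zero_le_real.2 (hlam w ⟨u, hw⟩).le) v
  refine ⟨fun hu v huv => ?_, fun h => ?_⟩
  · have hv := hlam v ⟨u, huv⟩
    rw [← Submodule.smul_mem_iff (s := (lam v : ℂ)) _ (Complex.ofReal_ne_zero.2 hv.ne')]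
    refine mem_stableSubspace_of_le hpos (fun w => ?_) (fun w => ?_)
      (apply_mem_stableSubspace_iff.2 hu)
    · rw [lp.coeFn_smul, Pi.smul_apply, smul_eq_mul]
      exact mul_nonneg (Complex.zero_le_real.2 hv.le) (evec_nonneg v w)
    · rw [lp.coeFn_smul, Pi.smul_apply, smul_eq_mul]
      by_cases hw : w = v
      · subst hw
        simp [evec_apply_self, hS, huv]
      · simpa [evec_apply_of_ne hw] using hpos u w
  · rw [← apply_mem_stableSubspace_iff]
    refine (isClosed_stableSubspace hcon).mem_of_tendsto (hasSum_smul_evec (S (evec u)))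
      (Eventually.of_forall fun s => Submodule.sum_mem _ fun v _ => ?_)
    by_cases huv : E u v
    · exact Submodule.smul_mem _ _ (h v huv)
    · simp [hS, huv]

theorem rel_par {V : Type*} {E : V → V → Prop} {v : V} (h : ∃ u, E u v) : E (par E v) v := by
  rw [par, dif_pos h]
  exact h.choose_spec

/-- Structure of the stable subspace `H₀ = {h : ‖S_λⁿ h‖ → 0}` of a contractive weighted shift
on a directed tree: (i) stability of `e_u` propagates to all descendants; (ii) `e_u` is stable
iff all `e_v`, `v` a child of `u`, are stable (in particular `e_u` is stable when `u` is a
leaf); (iii) if `e_u` is not stable then neither is `e_{Par^k(u)}` whenever `Par^k(u)`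
exists. -/
theorem stmt_6 {V : Type*} (E : V → V → Prop) (hE : IsDirectedTree E)
    (lam : V → ℝ) (hlam : ∀ v, (∃ u, E u v) → 0 < lam v)
    (S : lp (fun _ : V => ℂ) 2 →L[ℂ] lp (fun _ : V => ℂ) 2)
    (hS : ∀ u v : V, (S (evec u)) v = Set.indicator {w | E u w} (fun w => (lam w : ℂ)) v)
    (hcon : ‖S‖ ≤ 1) :
    ∀ u : V,
      (Tendsto (fun n : ℕ => ‖(S ^ n) (evec u)‖) atTop (𝓝 0) →
        ∀ v ∈ ⋃ n : ℕ, (chi E)^[n] ({u} : Set V),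
          Tendsto (fun n : ℕ => ‖(S ^ n) (evec v)‖) atTop (𝓝 0)) ∧
      (Tendsto (fun n : ℕ => ‖(S ^ n) (evec u)‖) atTop (𝓝 0) ↔
        ∀ v : V, E u v → Tendsto (fun n : ℕ => ‖(S ^ n) (evec v)‖) atTop (𝓝 0)) ∧
      ((∀ w, ¬ E u w) → Tendsto (fun n : ℕ => ‖(S ^ n) (evec u)‖) atTop (𝓝 0)) ∧
      (¬ Tendsto (fun n : ℕ => ‖(S ^ n) (evec u)‖) atTop (𝓝 0) →
        ∀ k : ℕ, parIterExists E k u →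
          ¬ Tendsto (fun n : ℕ => ‖(S ^ n) (evec ((par E)^[k] u))‖) atTop (𝓝 0)) := by
  intro u
  simp only [← mem_stableSubspace]
  have key := evec_mem_stableSubspace_iff hlam hS hcon
  refine ⟨fun hu v hv => ?_, key u, fun h => (key u).2 fun v hv => absurd hv (h v),
    fun hu k hk => ?_⟩
  · obtain ⟨n, hn⟩ := Set.mem_iUnion.1 hv
    clear hv
    induction n generalizing v with
    | zero => simpa [Set.mem_singleton_iff.1 hn] using hu
    | succ n ih =>
      rw [Function.iterate_succ_apply'] at hn
      obtain ⟨w, hw, hwv⟩ := hn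
      exact (key w).1 (ih w hw) v hwv
  · induction k with
    | zero => exact hu
    | succ k ih =>
      rw [Function.iterate_succ_apply']
      exact fun h => ih (fun j hj => hk j (by omega))
        ((key _).1 h _ (rel_par (hk k (Nat.lt_succ_self k))))
end

section
/- Let S_λ be a contractive weighted shift with strictly positive weights on a rootless directed tree 𝒯 = (V, E), and let A_* be the asymptotic limit of S_λ*. For u ∈ V put h_u = ∑_{v ∈ Gen(u)} (∏_{j=0}^∞ λ_{Par^j(v)}) e_v. Then: h_u is a well-defined vector of ℓ²(V); h_u = h_v whenever v ∈ Gen(u); A_* h_u = a_u h_u where a_u = ‖h_u‖² = ∑_{v∈Gen(u)} ∏_{j=0}^∞ λ_{Par^j(v)}²; the orthogonal complement of the stable subspace H₀(S_λ*) equals the closed linear span of {h_u : u ∈ V}; and if h_u ≠ 0 for one vertex u, then h_u ≠ 0 for every u ∈ V. -/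
open Filter Topology

section Tree

variable {V : Type*} {E : V → V → Prop}

theorem edge_iff_par_eq (hE : IsDirectedTree E) (hr : ∀ v, ∃ u, E u v) {u v : V} :
    E u v ↔ par E v = u := by
  have h : E (par E v) v := by
    rw [par, dif_pos (hr v)]
    exact (hr v).choose_spec
  exact ⟨fun h' => hE.2.1 _ _ _ h h', fun h' => h' ▸ h⟩

theorem mem_chi_iterate (hE : IsDirectedTree E) (hr : ∀ v, ∃ u, E u v) (n : ℕ) (u v : V) :
    v ∈ (chi E)^[n] {u} ↔ (par E)^[n] v = u := by
  induction n generalizing v with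
  | zero => simp
  | succ n ih =>
    simp [Function.iterate_succ_apply' (chi E), chi, Function.iterate_succ_apply (par E),
      edge_iff_par_eq hE hr, ih]

theorem mem_gen_iff (hE : IsDirectedTree E) (hr : ∀ v, ∃ u, E u v) {u v : V} :
    v ∈ gen E u ↔ ∃ n, (par E)^[n] v = (par E)^[n] u := by
  simp [gen, mem_chi_iterate hE hr]

theorem iterate_eq_of_le {α : Type*} {f : α → α} {a b : α} {m n : ℕ} (hmn : m ≤ n)
    (h : f^[m] a = f^[m] b) : f^[n] a = f^[n] b := by
  obtain ⟨k, rfl⟩ := Nat.exists_eq_add_of_le' hmn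
  simp only [Function.iterate_add_apply, h]

theorem self_mem_gen (hE : IsDirectedTree E) (hr : ∀ v, ∃ u, E u v) (u : V) : u ∈ gen E u :=
  (mem_gen_iff hE hr).2 ⟨0, rfl⟩

theorem gen_eq_of_mem (hE : IsDirectedTree E) (hr : ∀ v, ∃ u, E u v) {u v : V}
    (h : v ∈ gen E u) : gen E u = gen E v := by
  obtain ⟨m, hm⟩ := (mem_gen_iff hE hr).1 h
  ext w
  simp only [mem_gen_iff hE hr]
  constructor
  · rintro ⟨n, hn⟩
    exact ⟨max m n, (iterate_eq_of_le (le_max_right m n) hn).trans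
      (iterate_eq_of_le (le_max_left m n) hm).symm⟩
  · rintro ⟨n, hn⟩
    exact ⟨max m n, (iterate_eq_of_le (le_max_right m n) hn).trans
      (iterate_eq_of_le (le_max_left m n) hm)⟩

theorem finset_iterate_par_eq (hE : IsDirectedTree E) (hr : ∀ v, ∃ u, E u v) (u : V)
    (s : Finset V) : ∃ n, ∀ v ∈ s, v ∈ gen E u → (par E)^[n] v = (par E)^[n] u := by
  have h : ∀ v ∈ s, ∀ᶠ n in atTop, v ∈ gen E u → (par E)^[n] v = (par E)^[n] u := by
    intro v _
    by_cases hv : v ∈ gen E u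
    · obtain ⟨m, hm⟩ := (mem_gen_iff hE hr).1 hv
      filter_upwards [eventually_ge_atTop m] with n hn _
      exact iterate_eq_of_le hn hm
    · simp [hv]
  exact ((Filter.eventually_all_finset s).2 h).exists

/-- The product `∏_{j < n} λ_{Par^j(v)}` of the weights along the path of length `n` above `v`. -/
noncomputable def pathWeight (E : V → V → Prop) (lam : V → ℝ) (n : ℕ) (v : V) : ℝ :=
  ∏ j ∈ Finset.range n, lam ((par E)^[j] v)

theorem pathWeight_succ (lam : V → ℝ) (n : ℕ) (v : V) :
    pathWeight E lam (n + 1) v = lam v * pathWeight E lam n (par E v) := by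
  simp [pathWeight, Finset.prod_range_succ', mul_comm]

theorem limit_eq_mul_limit_par {lam P : V → ℝ}
    (hP : ∀ v, Tendsto (fun n => pathWeight E lam n v) atTop (𝓝 (P v))) (v : V) :
    P v = lam v * P (par E v) := by
  refine tendsto_nhds_unique ((hP v).comp (tendsto_add_atTop_nat 1)) ?_
  simpa only [Function.comp_def, pathWeight_succ] using (hP (par E v)).const_mul (lam v)

theorem limit_ne_zero_iff (hE : IsDirectedTree E) (hr : ∀ v, ∃ u, E u v) {lam P : V → ℝ}
    (hlam : ∀ v, 0 < lam v)
    (hP : ∀ v, Tendsto (fun n => pathWeight E lam n v) atTop (𝓝 (P v))) (u v : V) :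
    P u ≠ 0 ↔ P v ≠ 0 := by
  have step : ∀ a b, E a b → (P a ≠ 0 ↔ P b ≠ 0) := by
    intro a b hab
    rw [limit_eq_mul_limit_par hP b, (edge_iff_par_eq hE hr).1 hab]
    simp [(hlam b).ne']
  induction hE.2.2.1 u v with
  | refl => rfl
  | tail _ h ih => exact ih.trans (h.elim (step _ _) fun h => (step _ _ h).symm)

end Tree

section Basis

variable {V : Type*}

theorem inner_evec_left (u : V) (x : lp (fun _ : V => ℂ) 2) : inner ℂ (evec u) x = x u := by
  let := Classical.decEq V
  rw [evec, lp.inner_single_left]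
  simp

theorem inner_evec_right (u : V) (x : lp (fun _ : V => ℂ) 2) :
    inner ℂ x (evec u) = (starRingEnd ℂ) (x u) := by
  rw [← inner_conj_symm, inner_evec_left]

open Classical in
theorem evec_apply (u v : V) : evec u v = if v = u then (1 : ℂ) else 0 := by
  rw [evec, lp.single_apply, Pi.single_apply]

theorem norm_evec (u : V) : ‖evec u‖ = 1 := by
  let := Classical.decEq V
  rw [evec, lp.norm_single (by norm_num), norm_one]

theorem continuousLinearMap_ext_evec {F : Type*} [AddCommMonoid F] [Module ℂ F]
    [TopologicalSpace F] [T2Space F] {f g : lp (fun _ : V => ℂ) 2 →L[ℂ] F}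
    (h : ∀ u, f (evec u) = g (evec u)) : f = g := by
  let := Classical.decEq V
  refine lp.ext_continuousLinearMap (by norm_num) fun i => ?_
  ext
  exact h i

theorem norm_sq_eq_tsum (x : lp (fun _ : V => ℂ) 2) : ‖x‖ ^ 2 = ∑' v, ‖x v‖ ^ 2 := by
  simpa using lp.norm_rpow_eq_tsum (p := 2) (by norm_num) x

theorem sum_norm_sq_le (x : lp (fun _ : V => ℂ) 2) (s : Finset V) :
    ∑ v ∈ s, ‖x v‖ ^ 2 ≤ ‖x‖ ^ 2 := by
  simpa using lp.sum_rpow_le_norm_rpow (p := 2) (by norm_num) x s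

end Basis

section Contraction

variable {H : Type*} [NormedAddCommGroup H] [InnerProductSpace ℂ H] {S A : H →L[ℂ] H}

theorem norm_pow_apply_le (hcon : ‖S‖ ≤ 1) (n : ℕ) (x : H) : ‖(S ^ n) x‖ ≤ ‖x‖ := by
  rcases n.eq_zero_or_pos with rfl | hn
  · simp
  · exact (S ^ n).le_of_opNorm_le ((norm_pow_le' S hn).trans (pow_le_one₀ (norm_nonneg _) hcon)) x
      |>.trans (one_mul _).le

variable [CompleteSpace H]

theorem inner_pow_apply_left (n : ℕ) (x y : H) :
    inner ℂ ((S ^ n) x) y = inner ℂ x ((ContinuousLinearMap.adjoint S ^ n) y) := by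
  rw [← ContinuousLinearMap.star_eq_adjoint, ← star_pow, ContinuousLinearMap.star_eq_adjoint,
    ContinuousLinearMap.adjoint_inner_right]

/-- The stable subspace of the adjoint of a contraction is the kernel of its asymptotic limit. -/
theorem tendsto_adjoint_pow_iff (hcon : ‖S‖ ≤ 1)
    (hA : ∀ x, Tendsto (fun n : ℕ => (S ^ n) ((ContinuousLinearMap.adjoint S ^ n) x))
      atTop (𝓝 (A x))) (x : H) :
    Tendsto (fun n : ℕ => ‖(ContinuousLinearMap.adjoint S ^ n) x‖) atTop (𝓝 0) ↔ A x = 0 := by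
  constructor
  · intro h
    refine tendsto_nhds_unique (hA x) (squeeze_zero_norm (fun n => ?_) h)
    exact norm_pow_apply_le hcon n _
  · intro h
    have h1 : Tendsto (fun n : ℕ => ‖(ContinuousLinearMap.adjoint S ^ n) x‖ ^ 2) atTop (𝓝 0) := by
      have h2 := (((hA x).inner (𝕜 := ℂ) (tendsto_const_nhds (x := x))).norm)
      rw [h, inner_zero_left, norm_zero] at h2
      refine h2.congr fun n => ?_
      rw [inner_pow_apply_left, inner_self_eq_norm_sq_to_K]
      simp
    simpa [Real.sqrt_sq] using h1.sqrt

end Contraction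

section Shift

variable {V : Type*} {E : V → V → Prop} {lam P : V → ℝ}
  {S A : lp (fun _ : V => ℂ) 2 →L[ℂ] lp (fun _ : V => ℂ) 2}

theorem shift_apply (hE : IsDirectedTree E) (hr : ∀ v, ∃ u, E u v)
    (hS : ∀ u v : V, (S (evec u)) v = Set.indicator {w | E u w} (fun w => (lam w : ℂ)) v)
    (x : lp (fun _ : V => ℂ) 2) (v : V) : (S x) v = lam v * x (par E v) := by
  have h : (lp.evalCLM ℂ (fun _ : V => ℂ) 2 v).comp S =
      (lam v : ℂ) • lp.evalCLM ℂ (fun _ : V => ℂ) 2 (par E v) := by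
    refine continuousLinearMap_ext_evec fun u => ?_
    change (S (evec u)) v = (lam v : ℂ) * evec u (par E v)
    rw [hS, evec_apply]
    by_cases h : par E v = u <;> simp [edge_iff_par_eq hE hr, h]
  exact DFunLike.congr_fun h x

theorem shift_pow_apply (hE : IsDirectedTree E) (hr : ∀ v, ∃ u, E u v)
    (hS : ∀ u v : V, (S (evec u)) v = Set.indicator {w | E u w} (fun w => (lam w : ℂ)) v)
    (n : ℕ) (x : lp (fun _ : V => ℂ) 2) (v : V) :
    ((S ^ n) x) v = pathWeight E lam n v * x ((par E)^[n] v) := by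
  induction n generalizing v with
  | zero => simp [pathWeight]
  | succ n ih =>
    rw [pow_succ', mul_apply_eq_comp, shift_apply hE hr hS, ih, pathWeight_succ,
      Function.iterate_succ_apply]
    push_cast
    ring

theorem adjoint_pow_evec (hE : IsDirectedTree E) (hr : ∀ v, ∃ u, E u v)
    (hS : ∀ u v : V, (S (evec u)) v = Set.indicator {w | E u w} (fun w => (lam w : ℂ)) v)
    (n : ℕ) (v : V) :
    (ContinuousLinearMap.adjoint S ^ n) (evec v) =
      (pathWeight E lam n v : ℂ) • evec ((par E)^[n] v) := by
  ext u
  rw [← inner_evec_left, ← inner_pow_apply_left, inner_evec_right, shift_pow_apply hE hr hS,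
    lp.coeFn_smul, Pi.smul_apply, evec_apply, evec_apply]
  by_cases h : (par E)^[n] v = u
  · simp [h]
  · simp [h, Ne.symm h]

theorem asymptoticLimit_evec_apply (hE : IsDirectedTree E) (hr : ∀ v, ∃ u, E u v)
    (hS : ∀ u v : V, (S (evec u)) v = Set.indicator {w | E u w} (fun w => (lam w : ℂ)) v)
    (hA : ∀ x, Tendsto (fun n : ℕ => (S ^ n) ((ContinuousLinearMap.adjoint S ^ n) x))
      atTop (𝓝 (A x)))
    (hP : ∀ v, Tendsto (fun n => pathWeight E lam n v) atTop (𝓝 (P v))) (v w : V) :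
    (A (evec v)) w = P w * Set.indicator (gen E w) (fun v => (P v : ℂ)) v := by
  have h1 := ((lp.evalCLM ℂ (fun _ : V => ℂ) 2 w).continuous.tendsto _).comp (hA (evec v))
  have h2 : ∀ n, (lp.evalCLM ℂ (fun _ : V => ℂ) 2 w)
      ((S ^ n) ((ContinuousLinearMap.adjoint S ^ n) (evec v))) =
      (pathWeight E lam n w : ℂ) *
        (pathWeight E lam n v * evec ((par E)^[n] v) ((par E)^[n] w)) := by
    intro n
    rw [adjoint_pow_evec hE hr hS]
    exact shift_pow_apply hE hr hS n _ w
  refine tendsto_nhds_unique h1 ?_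
  simp only [Function.comp_def, h2]
  refine ((Complex.continuous_ofReal.tendsto _).comp (hP w)).mul ?_
  by_cases hv : v ∈ gen E w
  · rw [Set.indicator_of_mem hv]
    obtain ⟨m, hm⟩ := (mem_gen_iff hE hr).1 hv
    refine ((Complex.continuous_ofReal.tendsto _).comp (hP v)).congr' ?_
    filter_upwards [eventually_ge_atTop m] with n hn
    simp [evec_apply, iterate_eq_of_le hn hm]
  · rw [Set.indicator_of_notMem hv]
    refine tendsto_const_nhds.congr fun n => ?_
    rw [evec_apply, if_neg, mul_zero]
    exact fun h => hv ((mem_gen_iff hE hr).2 ⟨n, h.symm⟩)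

theorem asymptoticLimit_apply (hE : IsDirectedTree E) (hr : ∀ v, ∃ u, E u v)
    (hS : ∀ u v : V, (S (evec u)) v = Set.indicator {w | E u w} (fun w => (lam w : ℂ)) v)
    (hA : ∀ x, Tendsto (fun n : ℕ => (S ^ n) ((ContinuousLinearMap.adjoint S ^ n) x))
      atTop (𝓝 (A x)))
    (hP : ∀ v, Tendsto (fun n => pathWeight E lam n v) atTop (𝓝 (P v))) {w : V}
    {h : lp (fun _ : V => ℂ) 2}
    (hh : ∀ v, h v = Set.indicator (gen E w) (fun v => (P v : ℂ)) v)
    (x : lp (fun _ : V => ℂ) 2) : (A x) w = P w * inner ℂ h x := by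
  have h1 : (lp.evalCLM ℂ (fun _ : V => ℂ) 2 w).comp A = (P w : ℂ) • innerSL ℂ h := by
    refine continuousLinearMap_ext_evec fun v => ?_
    change (A (evec v)) w = (P w : ℂ) * inner ℂ h (evec v)
    rw [asymptoticLimit_evec_apply hE hr hS hA hP, inner_evec_right, hh]
    by_cases hv : v ∈ gen E w <;> simp [hv]
  exact DFunLike.congr_fun h1 x

theorem weight_le_one (hE : IsDirectedTree E) (hr : ∀ v, ∃ u, E u v)
    (hS : ∀ u v : V, (S (evec u)) v = Set.indicator {w | E u w} (fun w => (lam w : ℂ)) v)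
    (hcon : ‖S‖ ≤ 1) (v : V) : lam v ≤ 1 := by
  have h1 : ‖(S (evec (par E v))) v‖ ≤ 1 :=
    calc _ ≤ ‖S (evec (par E v))‖ := lp.norm_apply_le_norm (by norm_num) _ v
      _ ≤ 1 * ‖evec (par E v)‖ := S.le_of_opNorm_le hcon _
      _ = 1 := by rw [norm_evec, one_mul]
  rw [shift_apply hE hr hS, evec_apply, if_pos rfl, mul_one, Complex.norm_real] at h1
  exact (le_abs_self _).trans h1

theorem limit_nonneg (hlam : ∀ v, 0 < lam v)
    (hP : ∀ v, Tendsto (fun n => pathWeight E lam n v) atTop (𝓝 (P v))) (v : V) : 0 ≤ P v :=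
  ge_of_tendsto' (hP v) fun _ => Finset.prod_nonneg fun _ _ => (hlam _).le

theorem limit_le_pathWeight (hlam : ∀ v, 0 < lam v) (hle : ∀ v, lam v ≤ 1)
    (hP : ∀ v, Tendsto (fun n => pathWeight E lam n v) atTop (𝓝 (P v))) (n : ℕ) (v : V) :
    P v ≤ pathWeight E lam n v := by
  refine (antitone_nat_of_succ_le fun k => ?_).le_of_tendsto (hP v) n
  rw [pathWeight, Finset.prod_range_succ]
  exact mul_le_of_le_one_right (Finset.prod_nonneg fun _ _ => (hlam _).le) (hle _)

theorem memℓp_indicator_gen (hE : IsDirectedTree E) (hr : ∀ v, ∃ u, E u v)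
    (hlam : ∀ v, 0 < lam v)
    (hS : ∀ u v : V, (S (evec u)) v = Set.indicator {w | E u w} (fun w => (lam w : ℂ)) v)
    (hcon : ‖S‖ ≤ 1)
    (hP : ∀ v, Tendsto (fun n => pathWeight E lam n v) atTop (𝓝 (P v))) (u : V) :
    Memℓp (fun v => Set.indicator (gen E u) (fun v => (P v : ℂ)) v) 2 := by
  refine memℓp_gen' (C := 1) fun s => ?_
  obtain ⟨n, hn⟩ := finset_iterate_par_eq hE hr u s
  set x := (S ^ n) (evec ((par E)^[n] u)) with hx
  have hx1 : ‖x‖ ≤ 1 := (norm_pow_apply_le hcon n _).trans (norm_evec _).le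
  refine le_trans (Finset.sum_le_sum fun v hv => ?_)
    ((sum_norm_sq_le x s).trans (pow_le_one₀ (norm_nonneg x) hx1))
  rw [ENNReal.toReal_ofNat, Real.rpow_two]
  by_cases hvu : v ∈ gen E u
  · rw [Set.indicator_of_mem hvu, hx, shift_pow_apply hE hr hS, evec_apply,
      if_pos (hn v hv hvu), mul_one, Complex.norm_real, Complex.norm_real]
    have h0 := limit_nonneg hlam hP v
    have h1 := limit_le_pathWeight hlam (weight_le_one hE hr hS hcon) hP n v
    gcongr
    rwa [Real.norm_of_nonneg h0, Real.norm_of_nonneg (h0.trans h1)]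
  · rw [Set.indicator_of_notMem hvu, norm_zero, zero_pow two_ne_zero]
    positivity

end Shift

/-- The asymptotic limit `A_*` of the adjoint of a contractive weighted shift on a rootless
directed tree.  With `P v = ∏_{j=0}^∞ λ_{Par^j(v)}` and
`h_u = ∑_{v ∈ Gen(u)} P v • e_v`: each `h_u` is a well-defined vector of `ℓ²(V)`,
`h_u = h_v` for `v ∈ Gen(u)`, `A_* h_u = a_u h_u` where
`a_u = ‖h_u‖² = ∑_{v ∈ Gen(u)} (P v)²`, the orthogonal complement of the stable subspace
`H₀(S_λ*)` is the closed linear span of `{h_u : u ∈ V}`, and if some `h_u` is nonzero then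
all of them are. -/
theorem stmt_8 {V : Type*} (E : V → V → Prop) (hE : IsDirectedTree E)
    (hrootless : ∀ v : V, ∃ u, E u v)
    (lam : V → ℝ) (hlam : ∀ v, 0 < lam v)
    (S : lp (fun _ : V => ℂ) 2 →L[ℂ] lp (fun _ : V => ℂ) 2)
    (hS : ∀ u v : V, (S (evec u)) v = Set.indicator {w | E u w} (fun w => (lam w : ℂ)) v)
    (hcon : ‖S‖ ≤ 1)
    (As : lp (fun _ : V => ℂ) 2 →L[ℂ] lp (fun _ : V => ℂ) 2)
    (hAs : ∀ x, Tendsto (fun n : ℕ => (S ^ n) (((ContinuousLinearMap.adjoint S) ^ n) x))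
      atTop (𝓝 (As x)))
    (P : V → ℝ)
    (hP : ∀ v : V, Tendsto (fun n : ℕ => ∏ j ∈ Finset.range n, lam ((par E)^[j] v))
      atTop (𝓝 (P v))) :
    (∀ u : V, Memℓp (fun v => Set.indicator (gen E u) (fun v => (P v : ℂ)) v) 2) ∧
    (∀ hvec : V → lp (fun _ : V => ℂ) 2,
      (∀ u v : V, (hvec u) v = Set.indicator (gen E u) (fun v => (P v : ℂ)) v) →
      ((∀ u v : V, v ∈ gen E u → hvec u = hvec v) ∧
       (∀ u : V, As (hvec u) = ((‖hvec u‖ ^ 2 : ℝ) : ℂ) • hvec u) ∧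
       (∀ u : V, ‖hvec u‖ ^ 2 =
          ∑' v : V, Set.indicator (gen E u) (fun v => (P v) ^ 2) v) ∧
       ((Submodule.span ℂ {x : lp (fun _ : V => ℂ) 2 |
           Tendsto (fun n : ℕ => ‖((ContinuousLinearMap.adjoint S) ^ n) x‖) atTop (𝓝 0)})ᗮ =
         (Submodule.span ℂ (Set.range hvec)).topologicalClosure) ∧
       ((∃ u : V, hvec u ≠ 0) → ∀ u : V, hvec u ≠ 0))) := by
  refine ⟨memℓp_indicator_gen hE hrootless hlam hS hcon hP, fun hvec hh => ?_⟩
  have hA := fun w => asymptoticLimit_apply hE hrootless hS hAs hP (hh w)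
  have hgen : ∀ u v : V, v ∈ gen E u → hvec u = hvec v := by
    intro u v huv
    ext w
    rw [hh, hh, gen_eq_of_mem hE hrootless huv]
  have hzero : ∀ w, P w = 0 → hvec w = 0 := by
    intro w hw
    ext v
    have hv : P v = 0 := not_ne_iff.1 fun h =>
      (limit_ne_zero_iff hE hrootless hlam hP v w).1 h hw
    simp [hh, hv]
  refine ⟨hgen, fun u => ?_, fun u => ?_, ?_, ?_⟩
  · ext w
    rw [hA, lp.coeFn_smul, Pi.smul_apply, smul_eq_mul, hh u w]
    by_cases hw : w ∈ gen E u
    · rw [← hgen u w hw, inner_self_eq_norm_sq_to_K, Set.indicator_of_mem hw, mul_comm]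
      simp
    · rw [Set.indicator_of_notMem hw, mul_zero, lp.inner_eq_tsum]
      convert mul_zero _
      refine (tsum_congr fun v => ?_).trans tsum_zero
      rw [hh, hh]
      by_cases hv : v ∈ gen E w
      · have hvu : v ∉ gen E u := fun h => hw <| by
          rw [gen_eq_of_mem hE hrootless h, ← gen_eq_of_mem hE hrootless hv]
          exact self_mem_gen hE hrootless w
        rw [Set.indicator_of_notMem hvu, inner_zero_right]
      · rw [Set.indicator_of_notMem hv, inner_zero_left]
  · rw [norm_sq_eq_tsum]
    refine tsum_congr fun v => ?_
    rw [hh]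
    by_cases hv : v ∈ gen E u <;> simp [hv]
  · rw [← Submodule.orthogonal_orthogonal_eq_closure]
    congr 1
    refine le_antisymm (Submodule.span_le.2 fun x hx => ?_) fun x hx => Submodule.subset_span ?_
    · rw [Set.mem_ofPred_eq, tendsto_adjoint_pow_iff hcon hAs] at hx
      rw [SetLike.mem_coe, Submodule.mem_orthogonal]
      intro y hy
      induction hy using Submodule.span_induction with
      | mem y hy =>
        obtain ⟨w, rfl⟩ := hy
        by_cases hw : P w = 0
        · rw [hzero w hw, inner_zero_left]
        · have h := hA w x
          rw [hx] at h
          simpa [hw] using h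
      | zero => exact inner_zero_left _
      | add y z _ _ hy hz => rw [inner_add_left, hy, hz, add_zero]
      | smul c y _ hy => rw [inner_smul_left, hy, mul_zero]
    · rw [Set.mem_ofPred_eq, tendsto_adjoint_pow_iff hcon hAs]
      ext w
      rw [hA, (Submodule.mem_orthogonal _ _).1 hx _ (Submodule.subset_span ⟨w, rfl⟩)]
      simp
  · rintro ⟨u, hu⟩ w hw
    have hPw : P w ≠ 0 := (limit_ne_zero_iff hE hrootless hlam hP u w).1 fun h => hu (hzero u h)
    have h := hh w w
    rw [hw, Set.indicator_of_mem (self_mem_gen hE hrootless w)] at h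
    exact hPw (by simpa using h.symm)
end
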